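/- The identity x²yx ≍ xyx² (where x and y are distinct letters) holds in the Kauffman monoid K_3. -/

import Mathlib

open scoped Classical

/-- Generators of the Kauffman monoid `K₃`. -/
inductive K3Gen : Type
  | h1 | h2 | c
deriving DecidableEq

namespace K3Gen

/-- The defining relations of the Kauffman monoid `K₃`:
`h₁h₂h₁ = h₁`, `h₂h₁h₂ = h₂`, `h₁² = ch₁ = h₁c`, `h₂² = ch₂ = h₂c`. -/
inductive K3Rel : FreeMonoid K3Gen → FreeMonoid K3Gen → Prop
  | braid1 : K3Rel (.of h1 * .of h2 * .of h1) (.of h1)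
  | braid2 : K3Rel (.of h2 * .of h1 * .of h2) (.of h2)
  | sq1 : K3Rel (.of h1 * .of h1) (.of c * .of h1)
  | comm1 : K3Rel (.of c * .of h1) (.of h1 * .of c)
  | sq2 : K3Rel (.of h2 * .of h2) (.of c * .of h2)
  | comm2 : K3Rel (.of c * .of h2) (.of h2 * .of c)

end K3Gen

/-- The congruence on the free monoid over the generators generated by the relations. -/
def K3Con : Con (FreeMonoid K3Gen) := conGen K3Gen.K3Rel

/-- The Kauffman monoid `K₃`. -/
def K3 : Type := K3Con.Quotient

instance : Monoid K3 := Con.monoid K3Con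

namespace K3

/-- The generator `h₁` of `K₃`. -/
def h1 : K3 := K3Con.mk' (.of .h1)
/-- The generator `h₂` of `K₃`. -/
def h2 : K3 := K3Con.mk' (.of .h2)
/-- The generator `c` of `K₃`. -/
def c : K3 := K3Con.mk' (.of .c)

end K3

/-- The identity `w ≍ w'` (words over the countably infinite alphabet `ℕ`) holds in the
monoid `M` if every monoid homomorphism from the free monoid over `ℕ` to `M` equalizes
`w` and `w'`. -/
def HoldsIn (M : Type*) [Monoid M] (w w' : List ℕ) : Prop :=
  ∀ φ : FreeMonoid ℕ →* M, φ (FreeMonoid.ofList w) = φ (FreeMonoid.ofList w')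


namespace K3

theorem b1 : h1 * (h2 * h1) = h1 := by
  rw [← mul_assoc]; exact (Con.eq K3Con).2 (ConGen.Rel.of _ _ .braid1)
theorem b2 : h2 * (h1 * h2) = h2 := by
  rw [← mul_assoc]; exact (Con.eq K3Con).2 (ConGen.Rel.of _ _ .braid2)
theorem s1 : h1 * h1 = c * h1 := (Con.eq K3Con).2 (ConGen.Rel.of _ _ .sq1)
theorem s2 : h2 * h2 = c * h2 := (Con.eq K3Con).2 (ConGen.Rel.of _ _ .sq2)
theorem c1 : Commute c h1 := (Con.eq K3Con).2 (ConGen.Rel.of _ _ .comm1)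
theorem c2 : Commute c h2 := (Con.eq K3Con).2 (ConGen.Rel.of _ _ .comm2)

/-- Induction on elements of `K₃`. -/
theorem ind {P : K3 → Prop} (one : P 1) (m1 : ∀ z, P z → P (h1 * z))
    (m2 : ∀ z, P z → P (h2 * z)) (mc : ∀ z, P z → P (c * z)) (z : K3) : P z := by
  obtain ⟨w, rfl⟩ := Con.mk'_surjective (c := K3Con) z
  induction w using FreeMonoid.inductionOn' with
  | one => exact one
  | of_mul g w ih =>
    cases g
    · exact m1 _ ih
    · exact m2 _ ih
    · exact mc _ ih

theorem central (z : K3) : Commute c z :=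
  ind (P := fun z => Commute c z) (Commute.one_right c) (fun _ h => c1.mul_right h)
    (fun _ h => c2.mul_right h) (fun _ h => (Commute.refl c).mul_right h) z

theorem normal_form (z : K3) : ∃ (n : ℕ) (m : K3), z = c ^ n * m ∧
    (m = 1 ∨ m = h1 ∨ m = h2 ∨ m = h1 * h2 ∨ m = h2 * h1) := by
  induction z using ind with
  | one => exact ⟨0, 1, by simp, by simp⟩
  | mc z ih =>
    obtain ⟨n, m, rfl, h⟩ := ih
    exact ⟨n + 1, m, by rw [pow_succ', mul_assoc], h⟩
  | m1 z ih =>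
    obtain ⟨n, m, rfl, h⟩ := ih
    have e : h1 * (c ^ n * m) = c ^ n * (h1 * m) := by
      rw [← mul_assoc, ← (c1.pow_left n).eq, mul_assoc]
    rw [e]
    rcases h with rfl | rfl | rfl | rfl | rfl
    · exact ⟨n, h1, by simp, by simp⟩
    · exact ⟨n + 1, h1, by rw [s1, pow_succ, mul_assoc], by simp⟩
    · exact ⟨n, _, rfl, by simp⟩
    · exact ⟨n + 1, h1 * h2, by rw [← mul_assoc h1, s1, pow_succ]; simp only [mul_assoc], by simp⟩
    · exact ⟨n, h1, by rw [b1], by simp⟩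
  | m2 z ih =>
    obtain ⟨n, m, rfl, h⟩ := ih
    have e : h2 * (c ^ n * m) = c ^ n * (h2 * m) := by
      rw [← mul_assoc, ← (c2.pow_left n).eq, mul_assoc]
    rw [e]
    rcases h with rfl | rfl | rfl | rfl | rfl
    · exact ⟨n, h2, by simp, by simp⟩
    · exact ⟨n, _, rfl, by simp⟩
    · exact ⟨n + 1, h2, by rw [s2, pow_succ, mul_assoc], by simp⟩
    · exact ⟨n, h2, by rw [b2], by simp⟩
    · exact ⟨n + 1, h2 * h1, by rw [← mul_assoc h2, s2, pow_succ]; simp only [mul_assoc], by simp⟩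

/-- Every square `z²` equals `t z` for a power `t` of the central element `c`. -/
theorem sq_eq (z : K3) : ∃ k : ℕ, z * z = c ^ k * z := by
  obtain ⟨n, m, rfl, h⟩ := normal_form z
  have key : ∃ k : ℕ, m * m = c ^ k * m := by
    rcases h with rfl | rfl | rfl | rfl | rfl
    · exact ⟨0, by simp⟩
    · exact ⟨1, by rw [s1, pow_one]⟩
    · exact ⟨1, by rw [s2, pow_one]⟩
    · exact ⟨0, by rw [mul_assoc, b2, pow_zero, one_mul]⟩
    · exact ⟨0, by rw [mul_assoc, b1, pow_zero, one_mul]⟩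
  obtain ⟨k, hk⟩ := key
  refine ⟨n + k, ?_⟩
  calc c ^ n * m * (c ^ n * m) = c ^ n * (m * c ^ n) * m := by simp only [mul_assoc]
    _ = c ^ n * (c ^ n * (m * m)) := by
      rw [← ((central m).pow_left n).eq]; simp only [mul_assoc]
    _ = c ^ (n + k) * (c ^ n * m) := by
      rw [hk, ← mul_assoc (c ^ n) (c ^ k), ← pow_add, ← mul_assoc, ← mul_assoc,
        ← pow_add, ← pow_add]
      congr 2; omega

end K3

/-- The identity `x²yx ≍ xyx²` (with `x` and `y` distinct letters) holds in the
Kauffman monoid `K₃`. -/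
theorem K3_holdsIn_x2yx_xyx2 (x y : ℕ) (hxy : x ≠ y) :
    HoldsIn K3 [x, x, y, x] [x, y, x, x] := by
  intro φ
  have e (a b d f : ℕ) : φ (FreeMonoid.ofList [a, b, d, f]) =
      φ (.of a) * φ (.of b) * (φ (.of d) * φ (.of f)) := by
    rw [← map_mul, ← map_mul, ← map_mul]; rfl
  rw [e, e]
  generalize φ (.of x) = X
  generalize φ (.of y) = Y
  obtain ⟨k, hk⟩ := K3.sq_eq X
  rw [hk, mul_assoc, ← mul_assoc (X * Y), ← ((K3.central (X * Y)).pow_left k).eq]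
  simp only [mul_assoc]
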